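/- Assume q_0 is supported in the Euclidean ball {y ∈ ℝ^d : ‖y‖₂ ≤ √d}. Then there is a universal constant C > 0 such that for every t > 0, E_{X ~ q_t}[ ‖∂_t ∇_x log q_t(X)‖₂² ] ≤ C d³ / σ_t⁶. -/

import Mathlib

open MeasureTheory ProbabilityTheory Real

noncomputable section

abbrev Vec (d : ℕ) := EuclideanSpace ℝ (Fin d)

def stdGaussian (d : ℕ) : Measure (Vec d) :=
  Measure.map (⇑(EuclideanSpace.equiv (Fin d) ℝ).symm)
    (Measure.pi fun _ : Fin d => gaussianReal 0 1)

/-- The law `q_u` of `e^{-u} θ + √(1 - e^{-2u}) g`, with `θ ~ q0` and `g ~ N(0, I_d)`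
independent. -/
def forwardLaw {d : ℕ} (q0 : Measure (Vec d)) (u : ℝ) : Measure (Vec d) :=
  Measure.map (fun p : Vec d × Vec d =>
      Real.exp (-u) • p.1 + Real.sqrt (1 - Real.exp (-2*u)) • p.2)
    (q0.prod (stdGaussian d))

/-- Gaussian weight `exp(-‖x - λ_t θ‖² / (2σ_t²))`. -/
def weight {d : ℕ} (t : ℝ) (x θ : Vec d) : ℝ :=
  Real.exp (-‖x - Real.exp (-t) • θ‖^2 / (2 * (1 - Real.exp (-2*t))))

/-- The conditional law `μ_{t,x}` of `θ` given `λ_t θ + σ_t g = x`: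
`dμ_{t,x}(θ) = Z_{t,x}⁻¹ exp(-‖x - λ_t θ‖²/(2σ_t²)) dq0(θ)`. -/
def condMeasure {d : ℕ} (q0 : Measure (Vec d)) (t : ℝ) (x : Vec d) : Measure (Vec d) :=
  (∫⁻ θ, ENNReal.ofReal (weight t x θ) ∂q0)⁻¹ •
    q0.withDensity fun θ => ENNReal.ofReal (weight t x θ)

/-- The conditional mean `m(t, x) = E_{t,x}[θ]`. -/
def condMean {d : ℕ} (q0 : Measure (Vec d)) (t : ℝ) (x : Vec d) : Vec d :=
  ∫ θ, θ ∂(condMeasure q0 t x)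

/-- Partial derivative in the `i`-th coordinate direction. -/
def pd {d : ℕ} (i : Fin d) (f : Vec d → ℝ) (x : Vec d) : ℝ :=
  fderiv ℝ f x (EuclideanSpace.single i 1)

/-- A product of nondegenerate real Gaussians has the product density. -/
lemma pi_gaussianReal_eq_withDensity {ι : Type*} [Fintype ι] (m : ι → ℝ) {v : NNReal}
    (hv : v ≠ 0) :
    Measure.pi (fun i => gaussianReal (m i) v) =
      volume.withDensity fun x : ι → ℝ => ENNReal.ofReal (∏ i, gaussianPDFReal (m i) v (x i)) := by
  refine Measure.pi_eq fun s hs => ?_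
  rw [withDensity_apply _ (MeasurableSet.univ_pi hs), ← ofReal_integral_eq_lintegral_ofReal]
  · rw [volume_pi, Measure.restrict_pi_pi,
      integral_fintype_prod_eq_prod (f := fun i y => gaussianPDFReal (m i) v y),
      ENNReal.ofReal_prod_of_nonneg
        fun i _ => integral_nonneg fun y => gaussianPDFReal_nonneg _ _ _]
    exact Finset.prod_congr rfl fun i _ => (gaussianReal_apply_eq_integral _ hv _).symm
  · exact (Integrable.fintype_prod fun i => integrable_gaussianPDFReal (m i) v).restrict
  · exact ae_of_all _ fun x => Finset.prod_nonneg fun i _ => gaussianPDFReal_nonneg _ _ _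

instance isProbabilityMeasure_stdGaussian_vec (d : ℕ) :
    IsProbabilityMeasure (_root_.stdGaussian d) :=
  Measure.isProbabilityMeasure_map (by fun_prop)

/-- The density of `a + s g`, `g ~ N(0, I_d)`. -/
lemma map_affine_stdGaussian {d : ℕ} (a : Vec d) {s : ℝ} (hs : 0 < s) :
    (_root_.stdGaussian d).map (fun g => a + s • g) =
      volume.withDensity fun x => ENNReal.ofReal
        ((√(2 * π * s ^ 2))⁻¹ ^ d * rexp (-‖x - a‖ ^ 2 / (2 * s ^ 2))) := by
  set v : NNReal := .mk (s ^ 2) (sq_nonneg s) with hv_def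
  have hv : v ≠ 0 := by
    intro h
    have : s ^ 2 = 0 := congrArg NNReal.toReal h
    exact hs.ne' (by simpa using this)
  have hpi : (Measure.pi fun _ : Fin d => gaussianReal 0 1).map (fun y i => a i + s * y i) =
      Measure.pi fun i => gaussianReal (a i) v := by
    have hcoord : ∀ i, (gaussianReal 0 1).map (fun y => a i + s * y) = gaussianReal (a i) v := by
      intro i
      have : (fun y => a i + s * y) = (fun y => a i + y) ∘ (fun y => s * y) := rfl
      rw [this, ← Measure.map_map (by fun_prop) (by fun_prop), gaussianReal_map_const_mul,
        gaussianReal_map_const_add]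
      simp [hv_def]
    have := Measure.pi_map_pi (μ := fun _ : Fin d => gaussianReal 0 1)
      (f := fun i y => a i + s * y)
      (hμ := fun i => by rw [hcoord i]; infer_instance) (fun i => by fun_prop)
    rw [this]
    simp_rw [hcoord]
  have hcomp : (_root_.stdGaussian d).map (fun g => a + s • g) =
      (Measure.pi fun i => gaussianReal (a i) v).map (WithLp.toLp 2) := by
    rw [← hpi, _root_.stdGaussian, Measure.map_map (by fun_prop) (by fun_prop),
      Measure.map_map (by fun_prop) (by fun_prop)]
    rfl
  rw [hcomp, pi_gaussianReal_eq_withDensity _ hv]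
  ext A hA
  rw [Measure.map_apply (by fun_prop) hA, withDensity_apply _ hA,
    withDensity_apply _ ((WithLp.measurable_toLp 2 _) hA),
    ← (PiLp.volume_preserving_toLp (Fin d)).setLIntegral_comp_preimage hA (by fun_prop)]
  refine lintegral_congr fun y => ?_
  congr 1
  simp only [gaussianPDFReal, Finset.prod_mul_distrib, Finset.prod_const, Finset.card_univ,
    Fintype.card_fin, ← Real.exp_sum, EuclideanSpace.norm_sq_eq]
  congr 2
  rw [← Finset.sum_div, ← Finset.sum_neg_distrib]
  simp [hv_def]

/-- Sixth moment of the standard Gaussian vector, up to a universal constant. -/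
lemma lintegral_norm_pow_six_stdGaussian_le {d : ℕ} (hd : 1 ≤ d) :
    ∫⁻ g, ENNReal.ofReal ((‖g‖ ^ 2 / d) ^ 3) ∂(_root_.stdGaussian d) ≤
      ∫⁻ y, ENNReal.ofReal (y ^ 6) ∂(gaussianReal 0 1) := by
  have hd0 : (0 : ℝ) < d := by exact_mod_cast hd
  have hpt : ∀ y : Fin d → ℝ, ENNReal.ofReal ((‖WithLp.toLp 2 y‖ ^ 2 / d) ^ 3) ≤
      ∑ i, ENNReal.ofReal (d : ℝ)⁻¹ * ENNReal.ofReal (y i ^ 6) := by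
    intro y
    rw [← Finset.mul_sum, ← ENNReal.ofReal_sum_of_nonneg fun i _ => by positivity,
      ← ENNReal.ofReal_mul (by positivity)]
    refine ENNReal.ofReal_le_ofReal ?_
    have h := pow_sum_div_card_le_sum_pow (s := Finset.univ) (f := fun i => y i ^ 2)
      (fun i _ => by positivity) 2
    simp only [Finset.card_univ, Fintype.card_fin, ← pow_mul] at h
    norm_num at h
    have hn : ‖WithLp.toLp 2 y‖ ^ 2 = ∑ i, y i ^ 2 := by simp [EuclideanSpace.norm_sq_eq]
    rw [hn]
    calc ((∑ i, y i ^ 2) / d) ^ 3 = (d : ℝ)⁻¹ * ((∑ i, y i ^ 2) ^ 3 / d ^ 2) := by field_simp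
      _ ≤ _ := by gcongr
  rw [_root_.stdGaussian, lintegral_map (by fun_prop) (by fun_prop)]
  refine (lintegral_mono hpt).trans ?_
  rw [lintegral_finsetSum _ fun i _ => by fun_prop]
  have hi : ∀ i : Fin d, ∫⁻ y : Fin d → ℝ, ENNReal.ofReal (d : ℝ)⁻¹ * ENNReal.ofReal (y i ^ 6)
      ∂(Measure.pi fun _ => gaussianReal 0 1) =
      ENNReal.ofReal (d : ℝ)⁻¹ * ∫⁻ y, ENNReal.ofReal (y ^ 6) ∂(gaussianReal 0 1) := by
    intro i
    rw [lintegral_const_mul _ (by fun_prop)]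
    congr 1
    exact (measurePreserving_eval (fun _ : Fin d => gaussianReal 0 1) i).lintegral_comp
      (f := fun y => ENNReal.ofReal (y ^ 6)) (by fun_prop)
  simp_rw [hi]
  rw [Finset.sum_const, Finset.card_univ, Fintype.card_fin, nsmul_eq_mul, ← mul_assoc,
    ENNReal.ofReal_inv_of_pos hd0, ENNReal.ofReal_natCast,
    ENNReal.mul_inv_cancel (by exact_mod_cast (by omega : d ≠ 0)) (by simp), one_mul]

lemma lintegral_pow_six_gaussianReal_ne_top :
    ∫⁻ y, ENNReal.ofReal (y ^ 6) ∂(gaussianReal 0 1) ≠ ⊤ := by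
  have h := (memLp_id_gaussianReal (μ := 0) (v := 1) 6).integrable_norm_pow (by norm_num)
  have h' := h.lintegral_lt_top.ne
  simpa [Even.pow_abs (by decide : Even 6)] using h'

lemma continuous_weight {d : ℕ} (u : ℝ) :
    Continuous fun p : Vec d × Vec d => weight u p.1 p.2 := by
  unfold weight
  fun_prop

lemma weight_pos {d : ℕ} (u : ℝ) (x θ : Vec d) : 0 < weight u x θ := Real.exp_pos _

lemma one_sub_exp_pos {u : ℝ} (hu : 0 < u) : 0 < 1 - rexp (-2 * u) := by
  rw [sub_pos, Real.exp_lt_one_iff]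
  linarith

lemma weight_le_one {d : ℕ} {u : ℝ} (hu : 0 < u) (x θ : Vec d) : weight u x θ ≤ 1 := by
  have := one_sub_exp_pos hu
  rw [weight, Real.exp_le_one_iff, neg_div, neg_nonpos]
  positivity

/-- A continuous function is integrable against a finite measure carried by a ball. -/
lemma integrable_of_continuous_of_ae_norm_le {d : ℕ} {q0 : Measure (Vec d)} [IsFiniteMeasure q0]
    {R : ℝ} (hq : ∀ᵐ y ∂q0, ‖y‖ ≤ R) {f : Vec d → ℝ} (hf : Continuous f) : Integrable f q0 := by
  obtain ⟨B, hB⟩ := (isCompact_closedBall (0 : Vec d) R).exists_bound_of_continuousOn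
    hf.continuousOn
  refine Integrable.of_bound hf.aestronglyMeasurable B ?_
  filter_upwards [hq] with y hy using hB y (by simpa using hy)

/-- Normalizing constant of the Gaussian convolution kernel at time `u`. -/
def gaussNorm (d : ℕ) (u : ℝ) : ℝ := (√(2 * π * (1 - rexp (-2 * u))))⁻¹ ^ d

lemma gaussNorm_pos (d : ℕ) {u : ℝ} (hu : 0 < u) : 0 < gaussNorm d u := by
  have := one_sub_exp_pos hu
  unfold gaussNorm
  positivity

/-- The unnormalized density `∫ exp(-‖x - λ_u θ‖² / (2σ_u²)) dq0(θ)`. -/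
def partitionFn {d : ℕ} (q0 : Measure (Vec d)) (u : ℝ) (x : Vec d) : ℝ := ∫ θ, weight u x θ ∂q0

lemma map_noise_stdGaussian {d : ℕ} (θ : Vec d) {u : ℝ} (hu : 0 < u) :
    (_root_.stdGaussian d).map (fun g => rexp (-u) • θ + √(1 - rexp (-2 * u)) • g) =
      volume.withDensity fun x => ENNReal.ofReal (gaussNorm d u * weight u x θ) := by
  have := one_sub_exp_pos hu
  rw [map_affine_stdGaussian _ (Real.sqrt_pos.2 this)]
  simp only [Real.sq_sqrt this.le, gaussNorm, weight]

lemma integrable_weight {d : ℕ} (q0 : Measure (Vec d)) [IsFiniteMeasure q0] {u : ℝ} (hu : 0 < u)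
    (x : Vec d) : Integrable (weight u x) q0 := by
  refine Integrable.of_bound (C := 1)
    ((continuous_weight u).comp (by fun_prop : Continuous fun θ => (x, θ))).aestronglyMeasurable
    (ae_of_all _ fun θ => ?_)
  rw [Real.norm_of_nonneg (weight_pos u x θ).le]
  exact weight_le_one hu x θ

lemma partitionFn_pos {d : ℕ} (q0 : Measure (Vec d)) [IsProbabilityMeasure q0] {u : ℝ} (hu : 0 < u)
    (x : Vec d) : 0 < partitionFn q0 u x :=
  integral_exp_pos (integrable_weight q0 hu x)

lemma continuous_partitionFn {d : ℕ} (q0 : Measure (Vec d)) [IsFiniteMeasure q0] {u : ℝ}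
    (hu : 0 < u) : Continuous (partitionFn q0 u) := by
  refine continuous_of_dominated (bound := fun _ => 1)
    (fun x => (integrable_weight q0 hu x).aestronglyMeasurable) (fun x => ae_of_all _ fun θ => ?_)
    (integrable_const _) (ae_of_all _ fun θ => ?_)
  · rw [Real.norm_of_nonneg (weight_pos u x θ).le]
    exact weight_le_one hu x θ
  · unfold weight
    fun_prop

lemma measurable_weight_left {d : ℕ} (u : ℝ) (θ : Vec d) :
    Measurable fun x : Vec d => weight u x θ :=
  ((continuous_weight u).comp (by fun_prop : Continuous fun x => (x, θ))).measurable

lemma forwardLaw_eq_withDensity {d : ℕ} (q0 : Measure (Vec d)) [IsProbabilityMeasure q0] {u : ℝ}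
    (hu : 0 < u) :
    forwardLaw q0 u =
      volume.withDensity fun x => ENNReal.ofReal (gaussNorm d u * partitionFn q0 u x) := by
  have hmeas : Measurable fun p : Vec d × Vec d =>
      ENNReal.ofReal (gaussNorm d u * weight u p.1 p.2) :=
    (continuous_const.mul (continuous_weight u)).measurable.ennreal_ofReal
  ext A hA
  rw [forwardLaw, Measure.map_apply (by fun_prop) hA, Measure.prod_apply
    ((by fun_prop : Measurable _) hA), withDensity_apply _ hA]
  have h1 : ∀ θ : Vec d, (_root_.stdGaussian d) (Prod.mk θ ⁻¹' ((fun p : Vec d × Vec d =>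
      rexp (-u) • p.1 + √(1 - rexp (-2 * u)) • p.2) ⁻¹' A)) =
      ∫⁻ x in A, ENNReal.ofReal (gaussNorm d u * weight u x θ) := by
    intro θ
    rw [← withDensity_apply _ hA, ← map_noise_stdGaussian θ hu,
      Measure.map_apply (by fun_prop) hA]
    rfl
  simp_rw [h1]
  rw [lintegral_lintegral_swap (by exact (hmeas.comp measurable_swap).aemeasurable)]
  refine lintegral_congr fun x => ?_
  rw [partitionFn, ← integral_const_mul, ofReal_integral_eq_lintegral_ofReal
    ((integrable_weight q0 hu x).const_mul _)
    (ae_of_all _ fun θ => mul_nonneg (gaussNorm_pos d hu).le (weight_pos u x θ).le)]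

/-- A continuous positive density of the forward law is the explicit Gaussian mixture density. -/
lemma density_eq_partitionFn {d : ℕ} (q0 : Measure (Vec d)) [IsProbabilityMeasure q0] {u : ℝ}
    (hu : 0 < u) {ρ : Vec d → ℝ}
    (hρ : forwardLaw q0 u = volume.withDensity fun x => ENNReal.ofReal (ρ x))
    (hpos : ∀ x, 0 < ρ x) (hc : Continuous ρ) (x : Vec d) :
    ρ x = gaussNorm d u * partitionFn q0 u x := by
  have hcont : Continuous fun x => gaussNorm d u * partitionFn q0 u x :=
    continuous_const.mul (continuous_partitionFn q0 hu)
  have : IsFiniteMeasure (forwardLaw q0 u) := by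
    unfold forwardLaw
    infer_instance
  have hne : ∫⁻ x, ENNReal.ofReal (ρ x) ≠ ⊤ := by
    have h := measure_ne_top (forwardLaw q0 u) Set.univ
    rwa [hρ, withDensity_apply _ MeasurableSet.univ, setLIntegral_univ] at h
  have hae := (withDensity_eq_iff hc.measurable.ennreal_ofReal.aemeasurable
    hcont.measurable.ennreal_ofReal.aemeasurable hne).1
    (hρ.symm.trans (forwardLaw_eq_withDensity q0 hu))
  have hae_real : ρ =ᵐ[volume] fun x => gaussNorm d u * partitionFn q0 u x := by
    filter_upwards [hae] with y hy
    rwa [ENNReal.ofReal_eq_ofReal_iff (hpos y).le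
      (mul_pos (gaussNorm_pos d hu) (partitionFn_pos q0 hu y)).le] at hy
  exact congrFun ((hc.ae_eq_iff_eq volume hcont).1 hae_real) x

/-- Disintegration of the joint law of `(X, θ)`: integrating a function of the noise
`X - λ_u θ` against the mixture. -/
lemma lintegral_lintegral_noise {d : ℕ} (q0 : Measure (Vec d)) [IsProbabilityMeasure q0] {u : ℝ}
    (hu : 0 < u) {F : Vec d → ENNReal} (hF : Measurable F) :
    ∫⁻ x, ∫⁻ θ, ENNReal.ofReal (gaussNorm d u * weight u x θ) * F (x - rexp (-u) • θ) ∂q0 =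
      ∫⁻ g, F (√(1 - rexp (-2 * u)) • g) ∂(_root_.stdGaussian d) := by
  have hmeas : Measurable fun p : Vec d × Vec d =>
      ENNReal.ofReal (gaussNorm d u * weight u p.1 p.2) :=
    (continuous_const.mul (continuous_weight u)).measurable.ennreal_ofReal
  rw [lintegral_lintegral_swap]
  swap
  · exact (hmeas.mul (hF.comp (by fun_prop))).aemeasurable
  have h1 : ∀ θ : Vec d,
      ∫⁻ x, ENNReal.ofReal (gaussNorm d u * weight u x θ) * F (x - rexp (-u) • θ) =
      ∫⁻ g, F (√(1 - rexp (-2 * u)) • g) ∂(_root_.stdGaussian d) := by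
    intro θ
    have hF' : Measurable fun x => F (x - rexp (-u) • θ) := hF.comp (by fun_prop)
    have h2 := lintegral_withDensity_eq_lintegral_mul volume
      (((measurable_weight_left u θ).const_mul (gaussNorm d u)).ennreal_ofReal) hF'
    simp only [Pi.mul_apply] at h2
    rw [← h2, ← map_noise_stdGaussian θ hu, lintegral_map hF' (by fun_prop)]
    simp
  simp_rw [h1]
  simp

lemma sq_integral_le_integral_sq {α : Type*} [MeasurableSpace α] {μ : Measure α}
    [IsProbabilityMeasure μ] {f : α → ℝ} (hf : Integrable f μ)
    (hf2 : Integrable (fun a => f a ^ 2) μ) : (∫ a, f a ∂μ) ^ 2 ≤ ∫ a, f a ^ 2 ∂μ := by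
  set m := ∫ a, f a ∂μ with hm
  have h0 : 0 ≤ ∫ a, (f a ^ 2 - 2 * m * f a + m ^ 2) ∂μ :=
    integral_nonneg fun a => (by nlinarith [sq_nonneg (f a - m)] :
      0 ≤ f a ^ 2 - 2 * m * f a + m ^ 2)
  rw [integral_add (by exact hf2.sub (hf.const_mul _)) (integrable_const _),
    integral_sub hf2 (hf.const_mul _), integral_const_mul, ← hm] at h0
  simp only [integral_const, probReal_univ, smul_eq_mul, one_mul] at h0
  nlinarith

/-- Chebyshev's association inequality for `R` and `R²`. -/
lemma integral_mul_integral_sq_le {α : Type*} [MeasurableSpace α] {μ : Measure α}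
    [IsProbabilityMeasure μ] {f : α → ℝ} (hf0 : ∀ a, 0 ≤ f a) (hf : Integrable f μ)
    (hf2 : Integrable (fun a => f a ^ 2) μ) (hf3 : Integrable (fun a => f a ^ 3) μ) :
    (∫ a, f a ∂μ) * ∫ a, f a ^ 2 ∂μ ≤ ∫ a, f a ^ 3 ∂μ := by
  set m := ∫ a, f a ∂μ with hm
  have hm0 : 0 ≤ m := integral_nonneg hf0
  have h0 : 0 ≤ ∫ a, (f a ^ 3 - m ^ 2 * f a - m * f a ^ 2 + m ^ 3) ∂μ := by
    refine integral_nonneg fun a => ?_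
    have : f a ^ 3 - m ^ 2 * f a - m * f a ^ 2 + m ^ 3 = (f a - m) ^ 2 * (f a + m) := by ring
    rw [this]
    exact mul_nonneg (sq_nonneg _) (add_nonneg (hf0 a) hm0)
  rw [integral_add (by exact (hf3.sub (hf.const_mul _)).sub (hf2.const_mul _)) (integrable_const _),
    integral_sub (by exact hf3.sub (hf.const_mul _)) (hf2.const_mul _),
    integral_sub hf3 (hf.const_mul _), integral_const_mul, integral_const_mul, ← hm] at h0
  simp only [integral_const, probReal_univ, smul_eq_mul, one_mul] at h0
  nlinarith

/-- The time derivative of the logarithm of the Gaussian weight, with `l = λ_t`, `v = σ_t²`. -/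
def logWeightDeriv {d : ℕ} (l v : ℝ) (x θ : Vec d) : ℝ :=
  -inner ℝ (x - l • θ) (l • θ) / v + ‖x - l • θ‖ ^ 2 * l ^ 2 / v ^ 2

@[fun_prop]
lemma continuous_logWeightDeriv {d : ℕ} (l v : ℝ) (x : Vec d) :
    Continuous (logWeightDeriv l v x) := by
  unfold logWeightDeriv
  fun_prop

lemma logWeightDeriv_sq_le {d : ℕ} (hd : 1 ≤ d) {l v : ℝ} (hl0 : 0 ≤ l) (hl : l ≤ 1) (hv0 : 0 < v)
    (hv : v ≤ 1) {x θ : Vec d} (hθ : ‖θ‖ ≤ √d) {R : ℝ} (hR : ‖x - l • θ‖ ^ 2 = v * d * R) :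
    logWeightDeriv l v x θ ^ 2 ≤ 2 * (d ^ 2 / v ^ 2) * (R + R ^ 2) := by
  have hd0 : (0 : ℝ) < d := by exact_mod_cast hd
  have hR0 : 0 ≤ R := by
    have : 0 ≤ v * d * R := hR ▸ sq_nonneg _
    exact nonneg_of_mul_nonneg_right this (by positivity)
  have hθ2 : ‖l • θ‖ ^ 2 ≤ d := by
    rw [norm_smul, Real.norm_of_nonneg hl0, mul_pow]
    have : ‖θ‖ ^ 2 ≤ d := by
      calc ‖θ‖ ^ 2 ≤ √(d : ℝ) ^ 2 := by gcongr
        _ = (d : ℝ) := Real.sq_sqrt hd0.le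
    nlinarith [sq_nonneg ‖θ‖, pow_le_one₀ hl0 hl (n := 2)]
  have hin : inner ℝ (x - l • θ) (l • θ) ^ 2 ≤ v * d * R * d := by
    calc inner ℝ (x - l • θ) (l • θ) ^ 2 ≤ (‖x - l • θ‖ * ‖l • θ‖) ^ 2 := by
          rw [← sq_abs]
          gcongr
          exact abs_real_inner_le_norm _ _
      _ = ‖x - l • θ‖ ^ 2 * ‖l • θ‖ ^ 2 := by ring
      _ ≤ _ := by rw [hR]; gcongr
  have hl4 : l ^ 4 ≤ 1 := pow_le_one₀ hl0 hl
  have h1 : (-inner ℝ (x - l • θ) (l • θ) / v) ^ 2 ≤ d ^ 2 / v ^ 2 * R := by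
    rw [div_pow, neg_sq, div_mul_eq_mul_div]
    gcongr
    calc _ ≤ v * d * R * d := hin
      _ ≤ 1 * d * R * d := by gcongr
      _ = _ := by ring
  have h2 : (‖x - l • θ‖ ^ 2 * l ^ 2 / v ^ 2) ^ 2 ≤ d ^ 2 / v ^ 2 * R ^ 2 := by
    rw [hR]
    calc (v * d * R * l ^ 2 / v ^ 2) ^ 2 = d ^ 2 / v ^ 2 * R ^ 2 * l ^ 4 := by field_simp
      _ ≤ d ^ 2 / v ^ 2 * R ^ 2 * 1 := by gcongr
      _ = _ := by ring
  unfold logWeightDeriv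
  nlinarith [add_sq_le (a := -inner ℝ (x - l • θ) (l • θ) / v)
    (b := ‖x - l • θ‖ ^ 2 * l ^ 2 / v ^ 2)]

lemma norm_add_four_sq_le {E : Type*} [SeminormedAddCommGroup E] (a b c e : E) :
    ‖a + b + c + e‖ ^ 2 ≤ 4 * (‖a‖ ^ 2 + ‖b‖ ^ 2 + ‖c‖ ^ 2 + ‖e‖ ^ 2) := by
  have h : ‖a + b + c + e‖ ≤ ‖a‖ + ‖b‖ + ‖c‖ + ‖e‖ := by
    refine (norm_add_le _ _).trans ?_
    gcongr
    exact norm_add₃_le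
  calc ‖a + b + c + e‖ ^ 2 ≤ (‖a‖ + ‖b‖ + ‖c‖ + ‖e‖) ^ 2 := by gcongr
    _ ≤ _ := by
      nlinarith [sq_nonneg (‖a‖ - ‖b‖), sq_nonneg (‖a‖ - ‖c‖), sq_nonneg (‖a‖ - ‖e‖),
        sq_nonneg (‖b‖ - ‖c‖), sq_nonneg (‖b‖ - ‖e‖), sq_nonneg (‖c‖ - ‖e‖)]

/-- Posterior bound: the time derivative of the score, written through posterior expectations,
is controlled by the sixth posterior moment of the normalized noise. -/
lemma sum_sq_scoreDeriv_le {d : ℕ} (hd : 1 ≤ d) (μ : Measure (Vec d)) [IsProbabilityMeasure μ]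
    (hμ : ∀ᵐ y ∂μ, ‖y‖ ≤ √d) {l v : ℝ} (hl0 : 0 ≤ l) (hl : l ≤ 1) (hv0 : 0 < v) (hv : v ≤ 1)
    (x : Vec d) :
    ∑ i, (-(∫ θ, (l * θ i + (x - l • θ) i * logWeightDeriv l v x θ) ∂μ) / v
        + 2 * l ^ 2 * (∫ θ, (x - l • θ) i ∂μ) / v ^ 2
        + (∫ θ, (x - l • θ) i ∂μ) * (∫ θ, logWeightDeriv l v x θ ∂μ) / v) ^ 2
      ≤ 48 * (d ^ 3 / v ^ 3) * (1 + ∫ θ, (‖x - l • θ‖ ^ 2 / (v * d)) ^ 3 ∂μ) := by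
  have hd1 : (1 : ℝ) ≤ d := by exact_mod_cast hd
  have hd0 : (0 : ℝ) < d := by linarith
  have hint : ∀ f : Vec d → ℝ, Continuous f → Integrable f μ := fun f hf =>
    integrable_of_continuous_of_ae_norm_le hμ hf
  set h : Vec d → ℝ := logWeightDeriv l v x
  have hhc : Continuous h := continuous_logWeightDeriv l v x
  set H := ∫ θ, h θ ∂μ
  set R : Vec d → ℝ := fun θ => ‖x - l • θ‖ ^ 2 / (v * d) with hRdef
  have hRc : Continuous R := by fun_prop
  have hR0 : ∀ θ, 0 ≤ R θ := fun θ => by positivity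
  have hR : ∀ θ, ‖x - l • θ‖ ^ 2 = v * d * R θ := fun θ => by simp only [hRdef]; field_simp
  set D : ℝ := d ^ 3 / v ^ 3 with hD
  have hD0 : 0 < D := by positivity
  let V : Vec d → Vec d := fun θ =>
    (-(l / v)) • θ + (-(h θ / v)) • (x - l • θ) + (2 * l ^ 2 / v ^ 2) • (x - l • θ)
      + (H / v) • (x - l • θ)
  have hVi : ∀ i, Continuous fun θ => V θ i := fun i => by fun_prop
  have hcoord : ∀ i, -(∫ θ, (l * θ i + (x - l • θ) i * h θ) ∂μ) / v
        + 2 * l ^ 2 * (∫ θ, (x - l • θ) i ∂μ) / v ^ 2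
        + (∫ θ, (x - l • θ) i ∂μ) * H / v = ∫ θ, V θ i ∂μ := by
    intro i
    have e : ∀ θ, V θ i = (-(1 / v)) * (l * θ i + (x - l • θ) i * h θ)
        + (2 * l ^ 2 / v ^ 2 + H / v) * (x - l • θ) i := by
      intro θ
      simp only [V, PiLp.add_apply, PiLp.smul_apply, PiLp.sub_apply, smul_eq_mul]
      ring
    simp_rw [e]
    rw [integral_add ((hint _ (by fun_prop)).const_mul _) ((hint _ (by fun_prop)).const_mul _),
      integral_const_mul, integral_const_mul]
    ring
  have hHsq : H ^ 2 ≤ 2 * (d ^ 2 / v ^ 2) * (∫ θ, R θ ∂μ + ∫ θ, R θ ^ 2 ∂μ) := by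
    refine (sq_integral_le_integral_sq (hint _ hhc) (hint _ (hhc.pow 2))).trans ?_
    rw [← integral_add (hint _ hRc) (hint (fun θ => R θ ^ 2) (hRc.pow 2)), ← integral_const_mul]
    refine integral_mono_ae (hint _ (hhc.pow 2)) (hint _ (by fun_prop)) ?_
    filter_upwards [hμ] with θ hθ using logWeightDeriv_sq_le hd hl0 hl hv0 hv hθ (hR θ)
  have hVsq : ∀ᵐ θ ∂μ, ‖V θ‖ ^ 2 ≤
      4 * (D + 2 * D * (R θ ^ 2 + R θ ^ 3) + 4 * D * R θ + H ^ 2 * (d / v) * R θ) := by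
    filter_upwards [hμ] with θ hθ
    refine (norm_add_four_sq_le _ _ _ _).trans ?_
    simp only [norm_smul, mul_pow, Real.norm_eq_abs, sq_abs, hR θ]
    have hθ2 : ‖θ‖ ^ 2 ≤ d := by
      calc ‖θ‖ ^ 2 ≤ √(d : ℝ) ^ 2 := by gcongr
        _ = (d : ℝ) := Real.sq_sqrt hd0.le
    have hl2 : l ^ 2 ≤ 1 := pow_le_one₀ hl0 hl
    have hl4 : l ^ 4 ≤ 1 := pow_le_one₀ hl0 hl
    have hdD : d / v ^ 3 ≤ D := by
      rw [hD]
      gcongr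
      exact le_self_pow₀ hd1 (by norm_num)
    have t1 : (-(l / v)) ^ 2 * ‖θ‖ ^ 2 ≤ D := by
      calc (-(l / v)) ^ 2 * ‖θ‖ ^ 2 = l ^ 2 * ‖θ‖ ^ 2 / v ^ 2 := by ring
        _ ≤ 1 * d / v ^ 3 := by
            gcongr ?_ / ?_
            · gcongr
            · exact pow_le_pow_of_le_one hv0.le hv (by norm_num)
        _ ≤ D := by rw [one_mul]; exact hdD
    have t2 : (-(h θ / v)) ^ 2 * (v * d * R θ) ≤ 2 * D * (R θ ^ 2 + R θ ^ 3) := by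
      calc (-(h θ / v)) ^ 2 * (v * d * R θ) = h θ ^ 2 * (d / v * R θ) := by field_simp
        _ ≤ (2 * (d ^ 2 / v ^ 2) * (R θ + R θ ^ 2)) * (d / v * R θ) := by
            have := hR0 θ
            gcongr
            exact logWeightDeriv_sq_le hd hl0 hl hv0 hv hθ (hR θ)
        _ = _ := by rw [hD]; field_simp
    have t3 : (2 * l ^ 2 / v ^ 2) ^ 2 * (v * d * R θ) ≤ 4 * D * R θ := by
      calc (2 * l ^ 2 / v ^ 2) ^ 2 * (v * d * R θ) = 4 * (l ^ 4 * (d / v ^ 3)) * R θ := by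
            field_simp; ring
        _ ≤ 4 * (1 * D) * R θ := by
            have := hR0 θ
            gcongr
        _ = _ := by ring
    have t4 : (H / v) ^ 2 * (v * d * R θ) = H ^ 2 * (d / v) * R θ := by field_simp
    linarith
  simp_rw [hcoord]
  set a := ∫ θ, R θ ∂μ with ha
  set b := ∫ θ, R θ ^ 2 ∂μ with hb
  set m := ∫ θ, R θ ^ 3 ∂μ with hm
  have ha0 : 0 ≤ a := integral_nonneg hR0
  have hb0 : 0 ≤ b := integral_nonneg fun θ => by positivity
  have hab : a * b ≤ m := integral_mul_integral_sq_le hR0 (hint _ hRc) (hint _ (hRc.pow 2))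
    (hint _ (hRc.pow 3))
  have haa : a ^ 2 ≤ b := sq_integral_le_integral_sq (hint _ hRc) (hint _ (hRc.pow 2))
  have hone : ∀ k : ℕ, k ≤ 3 → ∫ θ, R θ ^ k ∂μ ≤ 1 + m := by
    intro k hk
    have : ∫ θ, (1 + R θ ^ 3) ∂μ = 1 + m := by
      rw [integral_add (integrable_const _) (hint (fun θ => R θ ^ 3) (hRc.pow 3))]
      simp [hm]
    rw [← this]
    refine integral_mono (hint _ (hRc.pow k)) (hint _ (by fun_prop)) fun θ => ?_
    show R θ ^ k ≤ 1 + R θ ^ 3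
    rcases le_total (R θ) 1 with h1 | h1
    · have := pow_le_one₀ (hR0 θ) h1 (n := k)
      have := pow_nonneg (hR0 θ) 3
      linarith
    · have := pow_le_pow_right₀ h1 hk
      linarith
  have ha1 : a ≤ 1 + m := by simpa using hone 1 (by norm_num)
  have hb1 : b ≤ 1 + m := hone 2 (by norm_num)
  calc ∑ i, (∫ θ, V θ i ∂μ) ^ 2 ≤ ∑ i, ∫ θ, V θ i ^ 2 ∂μ :=
        Finset.sum_le_sum fun i _ =>
          sq_integral_le_integral_sq (hint _ (hVi i)) (hint _ ((hVi i).pow 2))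
    _ = ∫ θ, ‖V θ‖ ^ 2 ∂μ := by
        rw [← integral_finsetSum _ fun i _ => hint (fun θ => V θ i ^ 2) ((hVi i).pow 2)]
        simp [EuclideanSpace.norm_sq_eq]
    _ ≤ ∫ θ, 4 * (D + 2 * D * (R θ ^ 2 + R θ ^ 3) + 4 * D * R θ + H ^ 2 * (d / v) * R θ) ∂μ :=
        integral_mono_ae (hint _ (by fun_prop)) (hint _ (by fun_prop)) hVsq
    _ = 4 * (D + 2 * D * (b + m) + 4 * D * a + H ^ 2 * (d / v) * a) := by
        rw [integral_const_mul, integral_add (hint _ (by fun_prop)) (hint _ (by fun_prop)),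
          integral_add (hint _ (by fun_prop)) (hint _ (by fun_prop)),
          integral_add (hint _ (by fun_prop)) (hint _ (by fun_prop)),
          integral_const_mul, integral_const_mul, integral_const_mul,
          integral_add (hint _ (by fun_prop)) (hint _ (by fun_prop))]
        simp [ha, hb, hm]
    _ ≤ 4 * (D + 2 * D * (b + m) + 4 * D * a
          + 2 * (d ^ 2 / v ^ 2) * (a + b) * (d / v) * a) := by gcongr
    _ = 4 * D * (1 + 2 * (b + m) + 4 * a + 2 * (a ^ 2 + a * b)) := by
        rw [hD]; field_simp
    _ ≤ 4 * D * (12 * (1 + m)) := by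
        gcongr
        linarith
    _ = _ := by ring

/-- Differentiation under the integral sign for a measure carried by a ball. -/
lemma hasDerivAt_integral_of_continuousOn {d : ℕ} {q0 : Measure (Vec d)} [IsFiniteMeasure q0]
    {r : ℝ} (hq : ∀ᵐ y ∂q0, ‖y‖ ≤ r) {F F' : ℝ → Vec d → ℝ} {a ε : ℝ} (hε : 0 < ε)
    (hF : ∀ s ∈ Metric.closedBall a ε, Continuous (F s))
    (hF' : ContinuousOn (Function.uncurry F') (Metric.closedBall a ε ×ˢ Set.univ))
    (hder : ∀ s ∈ Metric.closedBall a ε, ∀ θ, HasDerivAt (fun v => F v θ) (F' s θ) s) :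
    HasDerivAt (fun s => ∫ θ, F s θ ∂q0) (∫ θ, F' a θ ∂q0) a := by
  have ha : a ∈ Metric.closedBall a ε := Metric.mem_closedBall_self hε.le
  have hnhds : Metric.closedBall a ε ∈ nhds a := Metric.closedBall_mem_nhds a hε
  obtain ⟨B, hB⟩ := ((isCompact_closedBall a ε).prod
    (isCompact_closedBall (0 : Vec d) r)).exists_bound_of_continuousOn
      (hF'.mono (Set.prod_mono_right (Set.subset_univ _)))
  have hF'a : Continuous (F' a) := by
    rw [← continuousOn_univ]
    exact hF'.comp (f := fun θ : Vec d => (a, θ)) (by fun_prop) fun θ _ => ⟨ha, Set.mem_univ _⟩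
  refine (hasDerivAt_integral_of_dominated_loc_of_deriv_le (bound := fun _ => B) hnhds ?_
    (integrable_of_continuous_of_ae_norm_le hq (hF a ha)) hF'a.aestronglyMeasurable ?_
    (integrable_const _) ?_).2
  · filter_upwards [hnhds] with s hs using (hF s hs).aestronglyMeasurable
  · filter_upwards [hq] with θ hθ s hs using hB (s, θ) ⟨hs, by simpa using hθ⟩
  · exact ae_of_all _ fun θ s hs => hder s hs θ

lemma hasDerivAt_weight_line {d : ℕ} {u : ℝ} (hu : 0 < u) (x e θ : Vec d) (s : ℝ) :
    HasDerivAt (fun s => weight u (x + s • e) θ)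
      (-inner ℝ (x + s • e - rexp (-u) • θ) e / (1 - rexp (-2 * u)) * weight u (x + s • e) θ) s := by
  have hσ := (one_sub_exp_pos hu).ne'
  have h1 : HasDerivAt (fun s : ℝ => x + s • e - rexp (-u) • θ) e s := by
    simpa using (((hasDerivAt_id s).smul_const e).const_add x).sub_const (rexp (-u) • θ)
  have h2 := (h1.norm_sq.fun_neg.div_const (2 * (1 - rexp (-2 * u)))).exp
  refine h2.congr_deriv ?_
  simp only [weight]
  field_simp

lemma hasDerivAt_weight_time {d : ℕ} {u : ℝ} (hu : 0 < u) (x θ : Vec d) :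
    HasDerivAt (fun v => weight v x θ)
      (logWeightDeriv (rexp (-u)) (1 - rexp (-2 * u)) x θ * weight u x θ) u := by
  have hσ := (one_sub_exp_pos hu).ne'
  have hl : HasDerivAt (fun v => rexp (-v)) (-rexp (-u)) u := by
    simpa using (hasDerivAt_neg u).exp
  have hv : HasDerivAt (fun v => 1 - rexp (-2 * v)) (2 * rexp (-2 * u)) u := by
    have := (((hasDerivAt_id u).const_mul (-2 : ℝ)).exp).const_sub 1
    refine this.congr_deriv ?_
    simp
    ring
  have h1 : HasDerivAt (fun v : ℝ => x - rexp (-v) • θ) (rexp (-u) • θ) u := by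
    simpa using (hl.smul_const θ).const_sub x
  have h2 := (h1.norm_sq.fun_neg.fun_div (hv.const_mul 2) (by simpa using hσ)).exp
  refine h2.congr_deriv ?_
  have hsq : rexp (-2 * u) = rexp (-u) ^ 2 := by
    rw [← Real.exp_nat_mul]
    congr 1
    push_cast
    ring
  simp only [weight, logWeightDeriv]
  rw [mul_comm]
  congr 1
  rw [← hsq]
  field_simp
  ring

lemma hasDerivAt_partitionFn_line {d : ℕ} {q0 : Measure (Vec d)} [IsFiniteMeasure q0]
    {r : ℝ} (hq : ∀ᵐ y ∂q0, ‖y‖ ≤ r) {u : ℝ} (hu : 0 < u) (x : Vec d) (i : Fin d) :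
    HasDerivAt (fun s : ℝ => partitionFn q0 u (x + s • EuclideanSpace.single i (1 : ℝ)))
      (-(∫ θ, (x - rexp (-u) • θ) i * weight u x θ ∂q0) / (1 - rexp (-2 * u))) 0 := by
  have h := hasDerivAt_integral_of_continuousOn hq (a := 0) (ε := 1) one_pos
    (F := fun s θ => weight u (x + s • EuclideanSpace.single i (1 : ℝ)) θ)
    (fun s _ => by unfold weight; fun_prop)
    (by unfold weight Function.uncurry; fun_prop)
    (fun s _ θ => hasDerivAt_weight_line hu x (EuclideanSpace.single i 1) θ s)
  refine h.congr_deriv ?_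
  rw [neg_div, ← integral_div, ← integral_neg]
  refine integral_congr_ae (ae_of_all _ fun θ => ?_)
  simp only [zero_smul, add_zero, EuclideanSpace.inner_single_right]
  simp
  ring

/-- The score of the Gaussian mixture. -/
lemma pd_log_density {d : ℕ} {q0 : Measure (Vec d)} [IsProbabilityMeasure q0]
    {r : ℝ} (hq : ∀ᵐ y ∂q0, ‖y‖ ≤ r) {u : ℝ} (hu : 0 < u) {ρ : Vec d → ℝ}
    (hρ : ∀ x, ρ x = gaussNorm d u * partitionFn q0 u x) (hdiff : Differentiable ℝ ρ)
    (x : Vec d) (i : Fin d) :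
    pd i (fun y => Real.log (ρ y)) x =
      -(∫ θ, (x - rexp (-u) • θ) i * weight u x θ ∂q0) /
        ((1 - rexp (-2 * u)) * partitionFn q0 u x) := by
  have hc := gaussNorm_pos d hu
  have hZ := partitionFn_pos q0 hu x
  have hσ := one_sub_exp_pos hu
  have hρx : ρ x ≠ 0 := by rw [hρ]; positivity
  have hlog : DifferentiableAt ℝ (fun y => Real.log (ρ y)) x := (hdiff x).log hρx
  have hline := hlog.hasFDerivAt.hasLineDerivAt (EuclideanSpace.single i (1 : ℝ))
  have hmix := ((hasDerivAt_partitionFn_line hq hu x i).const_mul (gaussNorm d u)).log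
    (by simpa using (mul_pos hc hZ).ne')
  have heq : (fun s : ℝ => Real.log (ρ (x + s • EuclideanSpace.single i (1 : ℝ)))) =
      fun s => Real.log (gaussNorm d u * partitionFn q0 u (x + s • EuclideanSpace.single i 1)) := by
    simp_rw [hρ]
  unfold HasLineDerivAt at hline
  rw [heq] at hline
  unfold pd
  rw [hline.unique hmix]
  simp only [zero_smul, add_zero]
  field_simp

lemma continuousOn_logWeightDeriv_mul_weight {d : ℕ} (x : Vec d) :
    ContinuousOn (fun p : ℝ × Vec d =>
      logWeightDeriv (rexp (-p.1)) (1 - rexp (-2 * p.1)) x p.2 * weight p.1 x p.2)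
      (Set.Ioi 0 ×ˢ Set.univ) := by
  have h : ∀ p ∈ Set.Ioi (0 : ℝ) ×ˢ (Set.univ : Set (Vec d)), 1 - rexp (-2 * p.1) ≠ 0 :=
    fun p hp => (one_sub_exp_pos hp.1).ne'
  have h2 : ∀ p ∈ Set.Ioi (0 : ℝ) ×ˢ (Set.univ : Set (Vec d)), 2 * (1 - rexp (-2 * p.1)) ≠ 0 :=
    fun p hp => mul_ne_zero two_ne_zero (h p hp)
  have h3 : ∀ p ∈ Set.Ioi (0 : ℝ) ×ˢ (Set.univ : Set (Vec d)), (1 - rexp (-2 * p.1)) ^ 2 ≠ 0 :=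
    fun p hp => pow_ne_zero 2 (h p hp)
  unfold logWeightDeriv weight
  fun_prop (disch := assumption)

lemma continuousOn_weight_time {d : ℕ} (x : Vec d) :
    ContinuousOn (fun p : ℝ × Vec d => weight p.1 x p.2) (Set.Ioi 0 ×ˢ Set.univ) := by
  have h2 : ∀ p ∈ Set.Ioi (0 : ℝ) ×ˢ (Set.univ : Set (Vec d)), 2 * (1 - rexp (-2 * p.1)) ≠ 0 :=
    fun p hp => mul_ne_zero two_ne_zero (one_sub_exp_pos hp.1).ne'
  unfold weight
  fun_prop (disch := assumption)

lemma closedBall_half_subset_Ioi {u : ℝ} (hu : 0 < u) :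
    Metric.closedBall u (u / 2) ⊆ Set.Ioi 0 := by
  intro s hs
  rw [Real.closedBall_eq_Icc] at hs
  have := hs.1
  simp only [Set.mem_Ioi]
  linarith

lemma hasDerivAt_partitionFn_time {d : ℕ} {q0 : Measure (Vec d)} [IsFiniteMeasure q0]
    {r : ℝ} (hq : ∀ᵐ y ∂q0, ‖y‖ ≤ r) {u : ℝ} (hu : 0 < u) (x : Vec d) :
    HasDerivAt (fun v => partitionFn q0 v x)
      (∫ θ, logWeightDeriv (rexp (-u)) (1 - rexp (-2 * u)) x θ * weight u x θ ∂q0) u := by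
  refine hasDerivAt_integral_of_continuousOn hq (a := u) (ε := u / 2) (half_pos hu)
    (F := fun v θ => weight v x θ)
    (F' := fun v θ => logWeightDeriv (rexp (-v)) (1 - rexp (-2 * v)) x θ * weight v x θ)
    (fun s _ => by unfold weight; fun_prop)
    ((continuousOn_logWeightDeriv_mul_weight x).mono
      (Set.prod_mono_left (closedBall_half_subset_Ioi hu)))
    (fun s hs θ => hasDerivAt_weight_time (closedBall_half_subset_Ioi hu hs) x θ)

lemma hasDerivAt_integral_noise_mul_weight {d : ℕ} {q0 : Measure (Vec d)} [IsFiniteMeasure q0]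
    {r : ℝ} (hq : ∀ᵐ y ∂q0, ‖y‖ ≤ r) {u : ℝ} (hu : 0 < u) (x : Vec d) (i : Fin d) :
    HasDerivAt (fun v => ∫ θ, (x - rexp (-v) • θ) i * weight v x θ ∂q0)
      (∫ θ, (rexp (-u) * θ i + (x - rexp (-u) • θ) i *
        logWeightDeriv (rexp (-u)) (1 - rexp (-2 * u)) x θ) * weight u x θ ∂q0) u := by
  have hsub := Set.prod_mono_left (t := (Set.univ : Set (Vec d))) (closedBall_half_subset_Ioi hu)
  have h := hasDerivAt_integral_of_continuousOn hq (a := u) (ε := u / 2) (half_pos hu)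
    (F := fun v θ => (x - rexp (-v) • θ) i * weight v x θ)
    (F' := fun v θ => rexp (-v) * θ i * weight v x θ + (x - rexp (-v) • θ) i *
        (logWeightDeriv (rexp (-v)) (1 - rexp (-2 * v)) x θ * weight v x θ))
    (fun s _ => by unfold weight; fun_prop) ?_ ?_
  · refine h.congr_deriv (integral_congr_ae (ae_of_all _ fun θ => ?_))
    simp only
    ring
  · have h1 := (continuousOn_weight_time x).mono hsub
    have h2 := (continuousOn_logWeightDeriv_mul_weight x).mono hsub
    have h3 : ContinuousOn (fun p : ℝ × Vec d => rexp (-p.1) * p.2 i)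
        (Metric.closedBall u (u / 2) ×ˢ Set.univ) := by fun_prop
    have h4 : ContinuousOn (fun p : ℝ × Vec d => (x - rexp (-p.1) • p.2) i)
        (Metric.closedBall u (u / 2) ×ˢ Set.univ) := by fun_prop
    exact (h3.mul h1).add (h4.mul h2)
  · intro s hs θ
    have hw := hasDerivAt_weight_time (closedBall_half_subset_Ioi hu hs) x θ
    have hl : HasDerivAt (fun v => rexp (-v)) (-rexp (-s)) s := by
      simpa using (hasDerivAt_neg s).exp
    have hY : HasDerivAt (fun v => (x - rexp (-v) • θ) i) (rexp (-s) * θ i) s := by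
      simpa using (hl.mul_const (θ i)).const_sub (x i)
    exact hY.mul hw

/-- The conditional law of `θ` given `λ_u θ + σ_u g = x`, as an exponential tilting. -/
def condLaw {d : ℕ} (q0 : Measure (Vec d)) (u : ℝ) (x : Vec d) : Measure (Vec d) :=
  q0.tilted fun θ => -‖x - rexp (-u) • θ‖ ^ 2 / (2 * (1 - rexp (-2 * u)))

lemma integral_condLaw {d : ℕ} (q0 : Measure (Vec d)) (u : ℝ) (x : Vec d) (f : Vec d → ℝ) :
    ∫ θ, f θ ∂(condLaw q0 u x) = (∫ θ, f θ * weight u x θ ∂q0) / partitionFn q0 u x := by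
  rw [condLaw, integral_tilted, ← integral_div]
  refine integral_congr_ae (ae_of_all _ fun θ => ?_)
  simp only [smul_eq_mul, weight, partitionFn]
  ring

/-- The time derivative of the score in terms of posterior expectations. -/
lemma deriv_score {d : ℕ} {q0 : Measure (Vec d)} [IsProbabilityMeasure q0]
    {r : ℝ} (hq : ∀ᵐ y ∂q0, ‖y‖ ≤ r) {ρ : ℝ → Vec d → ℝ}
    (hρ : ∀ u, 0 < u → ∀ x, ρ u x = gaussNorm d u * partitionFn q0 u x)
    (hdiff : ∀ u, 0 < u → Differentiable ℝ (ρ u)) {t : ℝ} (ht : 0 < t) (x : Vec d) (i : Fin d) :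
    deriv (fun u => pd i (fun y => Real.log (ρ u y)) x) t =
      -(∫ θ, (rexp (-t) * θ i + (x - rexp (-t) • θ) i *
          logWeightDeriv (rexp (-t)) (1 - rexp (-2 * t)) x θ) ∂(condLaw q0 t x))
          / (1 - rexp (-2 * t))
        + 2 * rexp (-t) ^ 2 * (∫ θ, (x - rexp (-t) • θ) i ∂(condLaw q0 t x))
          / (1 - rexp (-2 * t)) ^ 2
        + (∫ θ, (x - rexp (-t) • θ) i ∂(condLaw q0 t x)) *
          (∫ θ, logWeightDeriv (rexp (-t)) (1 - rexp (-2 * t)) x θ ∂(condLaw q0 t x))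
          / (1 - rexp (-2 * t)) := by
  have hσ := (one_sub_exp_pos ht).ne'
  have hZ := (partitionFn_pos q0 ht x).ne'
  have heq : (fun u => pd i (fun y => Real.log (ρ u y)) x) =ᶠ[nhds t] fun u =>
      -(∫ θ, (x - rexp (-u) • θ) i * weight u x θ ∂q0) /
        ((1 - rexp (-2 * u)) * partitionFn q0 u x) := by
    filter_upwards [Ioi_mem_nhds ht] with u hu using pd_log_density hq hu (hρ u hu) (hdiff u hu) x i
  have hv : HasDerivAt (fun v => 1 - rexp (-2 * v)) (2 * rexp (-t) ^ 2) t := by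
    have := (((hasDerivAt_id t).const_mul (-2 : ℝ)).exp).const_sub 1
    refine this.congr_deriv ?_
    rw [← Real.exp_nat_mul]
    simp
    ring
  have hder := (hasDerivAt_integral_noise_mul_weight hq ht x i).fun_neg.fun_div
    (hv.fun_mul (hasDerivAt_partitionFn_time hq ht x)) (mul_ne_zero hσ hZ)
  rw [heq.deriv_eq, hder.deriv]
  simp only [integral_condLaw]
  field_simp
  ring

lemma isProbabilityMeasure_condLaw {d : ℕ} (q0 : Measure (Vec d)) [IsProbabilityMeasure q0]
    {u : ℝ} (hu : 0 < u) (x : Vec d) : IsProbabilityMeasure (condLaw q0 u x) :=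
  isProbabilityMeasure_tilted (integrable_weight q0 hu x)

/-- The sixth moment of the normalized noise, averaged over the forward law. -/
lemma lintegral_forwardLaw_condLaw_moment_le {d : ℕ} (hd : 1 ≤ d) {q0 : Measure (Vec d)}
    [IsProbabilityMeasure q0] {r : ℝ} (hq : ∀ᵐ y ∂q0, ‖y‖ ≤ r) {t : ℝ} (ht : 0 < t) :
    ∫⁻ x, ENNReal.ofReal (1 + ∫ θ, (‖x - rexp (-t) • θ‖ ^ 2 / ((1 - rexp (-2 * t)) * d)) ^ 3
        ∂(condLaw q0 t x)) ∂(forwardLaw q0 t) ≤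
      1 + ∫⁻ y, ENNReal.ofReal (y ^ 6) ∂(gaussianReal 0 1) := by
  have hd0 : (0 : ℝ) < d := by exact_mod_cast hd
  have hσ := one_sub_exp_pos ht
  have hc := gaussNorm_pos d ht
  set v := 1 - rexp (-2 * t) with hv
  have hmeas : Measurable fun x => ENNReal.ofReal (gaussNorm d t * partitionFn q0 t x) :=
    (continuous_const.mul (continuous_partitionFn q0 ht)).measurable.ennreal_ofReal
  rw [forwardLaw_eq_withDensity q0 ht]
  refine (lintegral_withDensity_le_lintegral_mul volume hmeas _).trans ?_
  have hpt : ∀ x, ENNReal.ofReal (gaussNorm d t * partitionFn q0 t x) * ENNReal.ofReal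
      (1 + ∫ θ, (‖x - rexp (-t) • θ‖ ^ 2 / (v * d)) ^ 3 ∂(condLaw q0 t x)) =
      ∫⁻ θ, ENNReal.ofReal (gaussNorm d t * weight t x θ) *
        ENNReal.ofReal (1 + (‖x - rexp (-t) • θ‖ ^ 2 / (v * d)) ^ 3) ∂q0 := by
    intro x
    have hZ := partitionFn_pos q0 ht x
    have hwc : Continuous (weight t x) := by unfold weight; fun_prop
    have hint1 := integrable_weight q0 ht x
    have hint2 : Integrable (fun θ => (‖x - rexp (-t) • θ‖ ^ 2 / (v * d)) ^ 3 * weight t x θ) q0 :=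
      integrable_of_continuous_of_ae_norm_le hq (by fun_prop)
    have hw := fun θ => (weight_pos t x θ).le
    have hfun : ∀ θ, ENNReal.ofReal (gaussNorm d t * weight t x θ) *
        ENNReal.ofReal (1 + (‖x - rexp (-t) • θ‖ ^ 2 / (v * d)) ^ 3) =
        ENNReal.ofReal (gaussNorm d t *
          (weight t x θ + (‖x - rexp (-t) • θ‖ ^ 2 / (v * d)) ^ 3 * weight t x θ)) := by
      intro θ
      rw [← ENNReal.ofReal_mul (mul_nonneg hc.le (hw θ))]
      congr 1
      ring
    simp_rw [hfun]
    rw [← ofReal_integral_eq_lintegral_ofReal (by exact (hint1.add hint2).const_mul _)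
      (ae_of_all _ fun θ => mul_nonneg hc.le
        (add_nonneg (hw θ) (mul_nonneg (by positivity) (hw θ)))),
      integral_const_mul, integral_add hint1 hint2,
      ← ENNReal.ofReal_mul (by positivity), integral_condLaw]
    congr 1
    rw [← partitionFn]
    field_simp
  simp only [Pi.mul_apply, hpt]
  rw [lintegral_lintegral_noise q0 ht
    (F := fun y => ENNReal.ofReal (1 + (‖y‖ ^ 2 / (v * d)) ^ 3)) (by fun_prop)]
  have hg : ∀ g : Vec d, ENNReal.ofReal (1 + (‖√v • g‖ ^ 2 / (v * d)) ^ 3) =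
      1 + ENNReal.ofReal ((‖g‖ ^ 2 / d) ^ 3) := by
    intro g
    rw [ENNReal.ofReal_add zero_le_one (by positivity), ENNReal.ofReal_one, norm_smul,
      Real.norm_of_nonneg (Real.sqrt_nonneg _), mul_pow, Real.sq_sqrt hσ.le]
    congr 3
    field_simp
  rw [← hv]
  simp_rw [hg]
  rw [lintegral_add_left measurable_const]
  simp only [lintegral_const, measure_univ, mul_one]
  gcongr
  exact lintegral_norm_pow_six_stdGaussian_le hd

/-- **Lemma (second moment of the time derivative of the score).** Under the bounded-support
assumption, `E_{X ~ q_t}[‖∂_t ∇_x log q_t(X)‖²] ≤ C d³/σ_t⁶` for a universal constant `C`. -/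
theorem partial_t_score_second_moment :
    ∃ C > (0:ℝ),
    ∀ (d : ℕ), 1 ≤ d →
    ∀ (q0 : Measure (Vec d)), IsProbabilityMeasure q0 →
    (∀ᵐ y ∂q0, ‖y‖ ≤ Real.sqrt d) →
    ∀ (ρ : ℝ → Vec d → ℝ),
    (∀ u, 0 < u → forwardLaw q0 u = volume.withDensity fun x => ENNReal.ofReal (ρ u x)) →
    (∀ u, 0 < u → ∀ x, 0 < ρ u x) →
    (∀ u, 0 < u → ContDiff ℝ (⊤ : ℕ∞) (ρ u)) →
    -- the score is differentiable in time
    (∀ u, 0 < u → ∀ (x : Vec d) (i : Fin d),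
      DifferentiableAt ℝ (fun v => pd i (fun y => Real.log (ρ v y)) x) u) →
    ∀ (t : ℝ), 0 < t →
    ∫ x, ∑ i, (deriv (fun u => pd i (fun y => Real.log (ρ u y)) x) t)^2
        ∂(forwardLaw q0 t)
      ≤ C * (d:ℝ)^3 / (1 - Real.exp (-2*t))^3 := by
  set M := ∫⁻ y, ENNReal.ofReal (y ^ 6) ∂(gaussianReal 0 1)
  have hMtop : 1 + M ≠ ⊤ := ENNReal.add_ne_top.2
    ⟨ENNReal.one_ne_top, lintegral_pow_six_gaussianReal_ne_top⟩
  have hM0 : 0 < (1 + M).toReal :=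
    ENNReal.toReal_pos (by simp) hMtop
  refine ⟨48 * (1 + M).toReal, by positivity, ?_⟩
  intro d hd q0 _ hq ρ hρ hpos hsmooth _ t ht
  have hσ := one_sub_exp_pos ht
  have hdens : ∀ u, 0 < u → ∀ x, ρ u x = gaussNorm d u * partitionFn q0 u x := fun u hu =>
    density_eq_partitionFn q0 hu (hρ u hu) (hpos u hu) (hsmooth u hu).continuous
  have hdiff : ∀ u, 0 < u → Differentiable ℝ (ρ u) := fun u hu =>
    (hsmooth u hu).differentiable (by simp)
  set K : ℝ := 48 * (d ^ 3 / (1 - rexp (-2 * t)) ^ 3) with hK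
  have hK0 : 0 ≤ K := by positivity
  have hbound : ∀ x, ∑ i, (deriv (fun u => pd i (fun y => Real.log (ρ u y)) x) t) ^ 2 ≤
      K * (1 + ∫ θ, (‖x - rexp (-t) • θ‖ ^ 2 / ((1 - rexp (-2 * t)) * d)) ^ 3
        ∂(condLaw q0 t x)) := by
    intro x
    have := isProbabilityMeasure_condLaw q0 ht x
    simp_rw [deriv_score hq hdens hdiff ht x]
    refine sum_sq_scoreDeriv_le hd (condLaw q0 t x)
      ((tilted_absolutelyContinuous q0 _).ae_le hq) (Real.exp_pos _).le
      (Real.exp_le_one_iff.2 (by linarith)) hσ (by linarith [Real.exp_pos (-2 * t)]) x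
  have hlint : ∫⁻ x, ENNReal.ofReal
      ‖∑ i, (deriv (fun u => pd i (fun y => Real.log (ρ u y)) x) t) ^ 2‖
      ∂(forwardLaw q0 t) ≤ ENNReal.ofReal K * (1 + M) := by
    refine le_trans (lintegral_mono fun x => ?_) (((lintegral_const_mul' (ENNReal.ofReal K) _
      ENNReal.ofReal_ne_top).le).trans
        (mul_le_mul_right (lintegral_forwardLaw_condLaw_moment_le hd hq ht) _))
    rw [← ENNReal.ofReal_mul hK0, Real.norm_of_nonneg (Finset.sum_nonneg fun i _ => sq_nonneg _)]
    exact ENNReal.ofReal_le_ofReal (hbound x)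
  calc _ ≤ ‖∫ x, ∑ i, (deriv (fun u => pd i (fun y => Real.log (ρ u y)) x) t) ^ 2
        ∂(forwardLaw q0 t)‖ := Real.le_norm_self _
    _ ≤ _ := norm_integral_le_lintegral_norm _
    _ ≤ (ENNReal.ofReal K * (1 + M)).toReal :=
        ENNReal.toReal_mono (ENNReal.mul_ne_top ENNReal.ofReal_ne_top hMtop) hlint
    _ = _ := by
        rw [ENNReal.toReal_mul, ENNReal.toReal_ofReal hK0, hK]
        ring

end
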